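/- Computational confluence of the sub-affine λ¢: if ⊢ t : A in the sub-affine type system and t reduces (via distribution reduction) to distributions D₁ and D₂, then D₁ and D₂ are computationally equivalent (D₁ ≡ D₂). -/

import Mathlib

/-- Terms of λ¢ (de Bruijn): variables, abstraction, application,
    booleans `one`/`zero`, if-then-else, and a coin. -/
inductive Tm : Type
  | var : Nat → Tm
  | lam : Tm → Tm
  | app : Tm → Tm → Tm
  | one : Tm
  | zero : Tm
  | ite : Tm → Tm → Tm → Tm
  | coin : Tm
  deriving DecidableEq

/-- Lifting of de Bruijn indices (indices ≥ d are incremented). -/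
def lift (d : Nat) : Tm → Tm
  | .var n => if n < d then .var n else .var (n+1)
  | .lam t => .lam (lift (d+1) t)
  | .app t u => .app (lift d t) (lift d u)
  | .one => .one
  | .zero => .zero
  | .ite c a b => .ite (lift d c) (lift d a) (lift d b)
  | .coin => .coin

/-- Capture-avoiding substitution `t[s/k]` (de Bruijn). -/
def subst : Tm → Nat → Tm → Tm
  | .var n, k, s => if n = k then s else if k < n then .var (n-1) else .var n
  | .lam t, k, s => .lam (subst t (k+1) (lift 0 s))
  | .app t u, k, s => .app (subst t k s) (subst u k s)
  | .one, _, _ => .one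
  | .zero, _, _ => .zero
  | .ite c a b, k, s => .ite (subst c k s) (subst a k s) (subst b k s)
  | .coin, _, _ => .coin

/-- One-step probabilistic reduction `t →_p r` of λ¢:
    β, if-rules (probability 1), coin toss (probability 1/2 each),
    closed under all contexts. -/
inductive Step : Tm → ℚ → Tm → Prop
  | beta (t r) : Step (.app (.lam t) r) 1 (subst t 0 r)
  | iteOne (a b) : Step (.ite .one a b) 1 a
  | iteZero (a b) : Step (.ite .zero a b) 1 b
  | coinOne : Step .coin (1/2) .one
  | coinZero : Step .coin (1/2) .zero
  | lam {t p t'} : Step t p t' → Step (.lam t) p (.lam t')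
  | appL {t p t'} (u) : Step t p t' → Step (.app t u) p (.app t' u)
  | appR {u p u'} (t) : Step u p u' → Step (.app t u) p (.app t u')
  | iteC {c p c'} (a b) : Step c p c' → Step (.ite c a b) p (.ite c' a b)
  | iteA {a p a'} (c b) : Step a p a' → Step (.ite c a b) p (.ite c a' b)
  | iteB {b p b'} (c a) : Step b p b' → Step (.ite c a b) p (.ite c a b')

/-- A term is normal if no probabilistic step applies. -/
def NormalTm (t : Tm) : Prop := ¬ ∃ p r, Step t p r

/-- (Sub)probability distributions over terms, as finitely supported maps. -/
abbrev PDist := Tm →₀ ℚ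

/-- Contraction of one redex occurrence of a term, producing the
    distribution of its results: deterministic rules give a Dirac
    distribution, a coin redex splits 1/2–1/2; closed under contexts. -/
inductive TStep : Tm → PDist → Prop
  | beta (t r) : TStep (.app (.lam t) r) (Finsupp.single (subst t 0 r) 1)
  | iteOne (a b) : TStep (.ite .one a b) (Finsupp.single a 1)
  | iteZero (a b) : TStep (.ite .zero a b) (Finsupp.single b 1)
  | coin : TStep .coin (Finsupp.single Tm.one (1/2) + Finsupp.single Tm.zero (1/2))
  | lam {t D} : TStep t D → TStep (.lam t) (D.mapDomain .lam)
  | appL {t D} (u) : TStep t D → TStep (.app t u) (D.mapDomain (fun s => .app s u))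
  | appR {u D} (t) : TStep u D → TStep (.app t u) (D.mapDomain (fun s => .app t s))
  | iteC {c D} (a b) : TStep c D → TStep (.ite c a b) (D.mapDomain (fun s => .ite s a b))
  | iteA {a D} (c b) : TStep a D → TStep (.ite c a b) (D.mapDomain (fun s => .ite c s b))
  | iteB {b D} (c a) : TStep b D → TStep (.ite c a b) (D.mapDomain (fun s => .ite c a s))

/-- One distribution-reduction step: pick a term `t` in the support,
    contract one redex occurrence of `t` and redistribute its probability
    mass accordingly (equal results are merged by the `Finsupp` addition). -/
def DStep (D D' : PDist) : Prop :=
  ∃ t E, D t ≠ 0 ∧ TStep t E ∧ D' = D.erase t + D t • E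

/-- Multistep distribution reduction. -/
def DSteps : PDist → PDist → Prop := Relation.ReflTransGen DStep

/-- A distribution is normal when every term in its support is normal. -/
def NormalDist (D : PDist) : Prop := ∀ t ∈ D.support, NormalTm t

/-- Simple types: booleans and arrows. -/
inductive Ty : Type
  | bool : Ty
  | arrow : Ty → Ty → Ty
  deriving DecidableEq

/-- Typing contexts for the (sub-)affine systems: a partial assignment of
    types to de Bruijn indices. -/
abbrev Ctx := Nat → Option Ty

/-- Extend a context with a (possibly absent) type for the new index 0. -/
def Ctx.cons (A : Option Ty) (Γ : Ctx) : Ctx := fun n =>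
  match n with
  | 0 => A
  | m+1 => Γ m

/-- Disjointness of contexts. -/
def Ctx.disj (Γ Δ : Ctx) : Prop := ∀ n, Γ n = none ∨ Δ n = none

/-- Union of (disjoint) contexts. -/
def Ctx.union (Γ Δ : Ctx) : Ctx := fun n => (Γ n).orElse (fun _ => Δ n)

/-- The empty context. -/
def Ctx.empty : Ctx := fun _ => none

/-- Sub-affine type system: affine, except that the two branches of an
    if-then-else may share their typing context. -/
inductive SubTy : Ctx → Tm → Ty → Prop
  | var {Γ n A} : Γ n = some A → SubTy Γ (.var n) A
  | lam {Γ t A B} : SubTy (Ctx.cons (some A) Γ) t B → SubTy Γ (.lam t) (.arrow A B)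
  | app {Γ Δ t u A B} : Ctx.disj Γ Δ →
      SubTy Γ t (.arrow A B) → SubTy Δ u A → SubTy (Ctx.union Γ Δ) (.app t u) B
  | one {Γ} : SubTy Γ .one .bool
  | zero {Γ} : SubTy Γ .zero .bool
  | coin {Γ} : SubTy Γ .coin .bool
  | ite {Γ Δ c a b A} : Ctx.disj Γ Δ →
      SubTy Γ c .bool → SubTy Δ a A → SubTy Δ b A →
      SubTy (Ctx.union Γ Δ) (.ite c a b) A

/-- Number of free occurrences of the de Bruijn variable `k` in a term. -/
def count : Nat → Tm → Nat
  | k, .var n => if n = k then 1 else 0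
  | k, .lam t => count (k+1) t
  | k, .app t u => count k t + count k u
  | k, .ite c a b => count k c + count k a + count k b
  | _, .one => 0
  | _, .zero => 0
  | _, .coin => 0

/-- Plugging a term into an elimination context C ::= ◇ | C v,
    represented as the list of arguments v. -/
def plug (t : Tm) (C : List Tm) : Tm := C.foldl .app t

/-- A term is closed when no de Bruijn index occurs free in it. -/
def ClosedTm (t : Tm) : Prop := ∀ k, count k t = 0

/-- `C` is an elimination context of type `A`: its arguments are closed
    normal terms and it takes every closed term of type `A` to a term of
    the basic type `𝔹`. -/
def ElimCtx (A : Ty) (C : List Tm) : Prop :=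
  (∀ v ∈ C, ClosedTm v ∧ NormalTm v) ∧
  (∀ t, SubTy Ctx.empty t A → SubTy Ctx.empty (plug t C) Ty.bool)

/-- Computational equivalence of distributions of closed terms of type `A`:
    for every elimination context of `A`, both distributions reduce to a
    common normal distribution (of results with accumulated probabilities). -/
def CompEquiv (A : Ty) (D E : PDist) : Prop :=
  ∀ C, ElimCtx A C →
    ∃ F, NormalDist F ∧
      DSteps (D.mapDomain (fun t => plug t C)) F ∧
      DSteps (E.mapDomain (fun t => plug t C)) F

namespace SubAffine

/-! ### Usage, size and affine terms -/

/-- Largest number of occurrences of the variable `k` on a single execution path: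
the two branches of a conditional count as alternatives. -/
def usage : ℕ → Tm → ℕ
  | k, .var n => if n = k then 1 else 0
  | k, .lam t => usage (k + 1) t
  | k, .app t u => usage k t + usage k u
  | k, .ite c a b => usage k c + max (usage k a) (usage k b)
  | _, .one => 0
  | _, .zero => 0
  | _, .coin => 0

/-- Size of a term, counting only the larger branch of each conditional. -/
def size : Tm → ℕ
  | .var _ => 0
  | .lam t => size t + 1
  | .app t u => size t + size u + 1
  | .ite c a b => size c + max (size a) (size b) + 1
  | .one => 0
  | .zero => 0
  | .coin => 1

/-- Every abstraction uses its variable at most once on each execution path. -/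
def AffineTm : Tm → Prop
  | .var _ => True
  | .lam t => usage 0 t ≤ 1 ∧ AffineTm t
  | .app t u => AffineTm t ∧ AffineTm u
  | .ite c a b => AffineTm c ∧ AffineTm a ∧ AffineTm b
  | .one => True
  | .zero => True
  | .coin => True

theorem usage_lift (s : Tm) (d j : ℕ) :
    usage j (lift d s) = if j < d then usage j s else if j = d then 0 else usage (j - 1) s := by
  induction s generalizing d j with
  | var n =>
    simp only [lift]
    split_ifs <;> simp only [usage] <;> split_ifs <;> omega
  | lam t ih =>
    simp only [lift, usage, ih]
    split_ifs <;> first | rfl | omega | (congr 1; omega)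
  | app t u iht ihu => simp only [lift, usage, iht, ihu]; split_ifs <;> rfl
  | ite c a b ihc iha ihb => simp only [lift, usage, ihc, iha, ihb]; split_ifs <;> rfl
  | one | zero | coin => simp [lift, usage]

theorem size_lift (s : Tm) (d : ℕ) : size (lift d s) = size s := by
  induction s generalizing d with
  | var n => simp only [lift]; split_ifs <;> rfl
  | lam t ih => simp only [lift, size, ih]
  | app t u iht ihu => simp only [lift, size, iht, ihu]
  | ite c a b ihc iha ihb => simp only [lift, size, ihc, iha, ihb]
  | one | zero | coin => rfl

theorem AffineTm.lift {s : Tm} (hs : AffineTm s) (d : ℕ) : AffineTm (lift d s) := by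
  induction s generalizing d with
  | var n => simp only [_root_.lift]; split_ifs <;> trivial
  | lam t ih => exact ⟨by simpa [usage_lift] using hs.1, ih hs.2 _⟩
  | app t u iht ihu => exact ⟨iht hs.1 _, ihu hs.2 _⟩
  | ite c a b ihc iha ihb => exact ⟨ihc hs.1 _, iha hs.2.1 _, ihb hs.2.2 _⟩
  | one | zero | coin => trivial

theorem branch_bound {c a b wc wa wb c' a' b' s : ℕ} (hc : c' ≤ c + wc * s)
    (ha : a' ≤ a + wa * s) (hb : b' ≤ b + wb * s) :
    c' + max a' b' ≤ c + max a b + (wc + max wa wb) * s := by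
  have h₁ : wa * s ≤ max wa wb * s := Nat.mul_le_mul_right _ (le_max_left _ _)
  have h₂ : wb * s ≤ max wa wb * s := Nat.mul_le_mul_right _ (le_max_right _ _)
  rw [add_mul]
  omega

theorem usage_subst_le (t : Tm) (k j : ℕ) (s : Tm) :
    usage j (subst t k s) ≤ usage (if j < k then j else j + 1) t + usage k t * usage j s := by
  induction t generalizing k j s with
  | var n =>
    by_cases h : n = k
    · simp [subst, usage, h]
    · simp only [subst, if_neg h]
      split_ifs <;> simp only [usage] <;> split_ifs <;> omega
  | lam t ih =>
    have h := ih (k + 1) (j + 1) (lift 0 s)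
    simp only [subst, usage]
    rw [usage_lift] at h
    by_cases hj : j < k <;> simpa [hj] using h
  | app t u iht ihu =>
    have ht := iht k j s
    have hu := ihu k j s
    simp only [subst, usage, add_mul]
    omega
  | ite c a b ihc iha ihb => exact branch_bound (ihc k j s) (iha k j s) (ihb k j s)
  | one | zero | coin => simp [subst, usage]

theorem size_subst_le (t : Tm) (k : ℕ) (s : Tm) :
    size (subst t k s) ≤ size t + usage k t * size s := by
  induction t generalizing k s with
  | var n =>
    simp only [subst]
    split_ifs with h <;> simp [size, usage, h]
  | lam t ih =>
    have h := ih (k + 1) (lift 0 s)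
    rw [size_lift] at h
    simp only [subst, size, usage]
    omega
  | app t u iht ihu =>
    have ht := iht k s
    have hu := ihu k s
    simp only [subst, size, usage, add_mul]
    omega
  | ite c a b ihc iha ihb =>
    have h := branch_bound (ihc k s) (iha k s) (ihb k s)
    simp only [subst, size, usage]
    omega
  | one | zero | coin => simp [subst, size]

theorem AffineTm.subst {t s : Tm} (ht : AffineTm t) (hs : AffineTm s) (k : ℕ) :
    AffineTm (subst t k s) := by
  induction t generalizing k s with
  | var n => simp only [_root_.subst]; split_ifs <;> first | exact hs | trivial
  | lam t ih =>
    refine ⟨?_, ih ht.2 (hs.lift 0) _⟩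
    have h := usage_subst_le t (k + 1) 0 (_root_.lift 0 s)
    simp only [usage_lift, Nat.zero_lt_succ, if_true, lt_irrefl, if_false, mul_zero] at h
    exact h.trans ht.1
  | app t u iht ihu => exact ⟨iht ht.1 hs _, ihu ht.2 hs _⟩
  | ite c a b ihc iha ihb => exact ⟨ihc ht.1 hs _, iha ht.2.1 hs _, ihb ht.2.2 hs _⟩
  | one | zero | coin => trivial

theorem union_eq_none {Γ Δ : Ctx} {n : ℕ} (h : Ctx.union Γ Δ n = none) :
    Γ n = none ∧ Δ n = none := by
  unfold Ctx.union at h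
  cases hΓ : Γ n <;> simp_all

theorem union_eq_some_left {Γ Δ : Ctx} {n : ℕ} {A : Ty} (h : Γ n = some A) :
    Ctx.union Γ Δ n = some A := by
  simp [Ctx.union, h]

theorem union_eq_some_right {Γ Δ : Ctx} {n : ℕ} {A : Ty} (hd : Ctx.disj Γ Δ)
    (h : Δ n = some A) : Ctx.union Γ Δ n = some A := by
  rcases hd n with hn | hn <;> simp_all [Ctx.union]

theorem usage_eq_zero_of_subTy {Γ : Ctx} {t : Tm} {A : Ty} (h : SubTy Γ t A) {n : ℕ}
    (hn : Γ n = none) : usage n t = 0 := by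
  induction h generalizing n with
  | @var _ m _ hm =>
    have : m ≠ n := by rintro rfl; simp_all
    simp [usage, this]
  | lam _ ih => exact ih (n := n + 1) hn
  | app _ _ _ iht ihu =>
    have := union_eq_none hn
    simp [usage, iht this.1, ihu this.2]
  | ite _ _ _ _ ihc iha ihb =>
    have := union_eq_none hn
    simp [usage, ihc this.1, iha this.2, ihb this.2]
  | one | zero | coin => rfl

theorem usage_le_one_of_subTy {Γ : Ctx} {t : Tm} {A : Ty} (h : SubTy Γ t A) (n : ℕ) :
    usage n t ≤ 1 := by
  induction h generalizing n with
  | var _ => simp only [usage]; split_ifs <;> simp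
  | lam _ ih => exact ih (n + 1)
  | app hd ht hu iht ihu =>
    have h₁ := iht n
    have h₂ := ihu n
    simp only [usage]
    rcases hd n with hn | hn
    · have := usage_eq_zero_of_subTy ht hn; omega
    · have := usage_eq_zero_of_subTy hu hn; omega
  | ite hd hc ha hb ihc iha ihb =>
    have h₁ := ihc n
    have h₂ := iha n
    have h₃ := ihb n
    simp only [usage]
    rcases hd n with hn | hn
    · have := usage_eq_zero_of_subTy hc hn; omega
    · have := usage_eq_zero_of_subTy ha hn
      have := usage_eq_zero_of_subTy hb hn
      omega
  | one | zero | coin => simp [usage]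

theorem affineTm_of_subTy {Γ : Ctx} {t : Tm} {A : Ty} (h : SubTy Γ t A) : AffineTm t := by
  induction h with
  | lam h ih => exact ⟨usage_le_one_of_subTy h 0, ih⟩
  | app _ _ _ iht ihu => exact ⟨iht, ihu⟩
  | ite _ _ _ _ ihc iha ihb => exact ⟨ihc, iha, ihb⟩
  | var | one | zero | coin => trivial

/-! ### Binary contraction -/

/-- The distribution giving probability `1/2` to each of `a` and `b`. -/
noncomputable def half (a b : Tm) : PDist := Finsupp.single a (1 / 2) + Finsupp.single b (1 / 2)

theorem half_self (a : Tm) : half a a = Finsupp.single a 1 := by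
  rw [half, ← Finsupp.single_add]; norm_num

theorem mapDomain_half (g : Tm → Tm) (a b : Tm) :
    (half a b).mapDomain g = half (g a) (g b) := by
  simp [half, Finsupp.mapDomain_add, Finsupp.mapDomain_single]

/-- Contraction of one redex, as a pair of equiprobable results; the results coincide
unless the redex is a coin. -/
inductive PairStep : Tm → Tm → Tm → Prop
  | beta (t r) : PairStep (.app (.lam t) r) (subst t 0 r) (subst t 0 r)
  | iteOne (a b) : PairStep (.ite .one a b) a a
  | iteZero (a b) : PairStep (.ite .zero a b) b b
  | coin : PairStep .coin .one .zero
  | lam {t x y} : PairStep t x y → PairStep (.lam t) (.lam x) (.lam y)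
  | appL {t x y} (u) : PairStep t x y → PairStep (.app t u) (.app x u) (.app y u)
  | appR {u x y} (t) : PairStep u x y → PairStep (.app t u) (.app t x) (.app t y)
  | iteC {c x y} (a b) : PairStep c x y → PairStep (.ite c a b) (.ite x a b) (.ite y a b)
  | iteA {a x y} (c b) : PairStep a x y → PairStep (.ite c a b) (.ite c x b) (.ite c y b)
  | iteB {b x y} (c a) : PairStep b x y → PairStep (.ite c a b) (.ite c a x) (.ite c a y)

theorem exists_pairStep {t : Tm} {E : PDist} (h : TStep t E) :
    ∃ x y, E = half x y ∧ PairStep t x y := by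
  induction h with
  | beta t r => exact ⟨_, _, (half_self _).symm, .beta t r⟩
  | iteOne a b => exact ⟨_, _, (half_self _).symm, .iteOne a b⟩
  | iteZero a b => exact ⟨_, _, (half_self _).symm, .iteZero a b⟩
  | coin => exact ⟨_, _, rfl, .coin⟩
  | lam _ ih =>
    obtain ⟨x, y, rfl, h⟩ := ih
    exact ⟨_, _, mapDomain_half _ _ _, .lam h⟩
  | appL u _ ih =>
    obtain ⟨x, y, rfl, h⟩ := ih
    exact ⟨_, _, mapDomain_half _ _ _, .appL u h⟩
  | appR t _ ih =>
    obtain ⟨x, y, rfl, h⟩ := ih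
    exact ⟨_, _, mapDomain_half _ _ _, .appR t h⟩
  | iteC a b _ ih =>
    obtain ⟨x, y, rfl, h⟩ := ih
    exact ⟨_, _, mapDomain_half _ _ _, .iteC a b h⟩
  | iteA c b _ ih =>
    obtain ⟨x, y, rfl, h⟩ := ih
    exact ⟨_, _, mapDomain_half _ _ _, .iteA c b h⟩
  | iteB c a _ ih =>
    obtain ⟨x, y, rfl, h⟩ := ih
    exact ⟨_, _, mapDomain_half _ _ _, .iteB c a h⟩

theorem PairStep.tStep {t x y : Tm} (h : PairStep t x y) : TStep t (half x y) := by
  induction h with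
  | beta t r => rw [half_self]; exact .beta t r
  | iteOne a b => rw [half_self]; exact .iteOne a b
  | iteZero a b => rw [half_self]; exact .iteZero a b
  | coin => exact .coin
  | lam _ ih => rw [← mapDomain_half]; exact .lam ih
  | appL u _ ih => rw [← mapDomain_half fun s => .app s u]; exact .appL u ih
  | appR t _ ih => rw [← mapDomain_half]; exact .appR t ih
  | iteC a b _ ih => rw [← mapDomain_half fun s => .ite s a b]; exact .iteC a b ih
  | iteA c b _ ih => rw [← mapDomain_half fun s => .ite c s b]; exact .iteA c b ih
  | iteB c a _ ih => rw [← mapDomain_half]; exact .iteB c a ih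

theorem usage_beta_le {t r : Tm} (ht : usage 0 t ≤ 1) (k : ℕ) :
    usage k (subst t 0 r) ≤ usage k (.app (.lam t) r) := by
  have h := usage_subst_le t 0 k r
  have h' := Nat.mul_le_mul_right (usage k r) ht
  simp only [Nat.not_lt_zero, if_false] at h
  simp only [usage]
  omega

theorem PairStep.usage_le {t x y : Tm} (h : PairStep t x y) (ht : AffineTm t) (k : ℕ) :
    usage k x ≤ usage k t ∧ usage k y ≤ usage k t := by
  induction h generalizing k with
  | beta t r => exact ⟨usage_beta_le ht.1.1 k, usage_beta_le ht.1.1 k⟩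
  | iteOne | iteZero | coin => simp [usage]
  | lam _ ih => exact ih ht.2 (k + 1)
  | appL u _ ih => have := ih ht.1 k; simp only [usage]; omega
  | appR t _ ih => have := ih ht.2 k; simp only [usage]; omega
  | iteC a b _ ih => have := ih ht.1 k; simp only [usage]; omega
  | iteA c b _ ih => have := ih ht.2.1 k; simp only [usage]; omega
  | iteB c a _ ih => have := ih ht.2.2 k; simp only [usage]; omega

theorem PairStep.affineTm {t x y : Tm} (h : PairStep t x y) (ht : AffineTm t) :
    AffineTm x ∧ AffineTm y := by
  induction h with
  | beta t r => exact ⟨ht.1.2.subst ht.2 0, ht.1.2.subst ht.2 0⟩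
  | iteOne a b => exact ⟨ht.2.1, ht.2.1⟩
  | iteZero a b => exact ⟨ht.2.2, ht.2.2⟩
  | coin => exact ⟨trivial, trivial⟩
  | lam h ih =>
    have hu := h.usage_le ht.2 0
    exact ⟨⟨hu.1.trans ht.1, (ih ht.2).1⟩, ⟨hu.2.trans ht.1, (ih ht.2).2⟩⟩
  | appL u _ ih => exact ⟨⟨(ih ht.1).1, ht.2⟩, ⟨(ih ht.1).2, ht.2⟩⟩
  | appR t _ ih => exact ⟨⟨ht.1, (ih ht.2).1⟩, ⟨ht.1, (ih ht.2).2⟩⟩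
  | iteC a b _ ih => exact ⟨⟨(ih ht.1).1, ht.2⟩, ⟨(ih ht.1).2, ht.2⟩⟩
  | iteA c b _ ih =>
    exact ⟨⟨ht.1, (ih ht.2.1).1, ht.2.2⟩, ⟨ht.1, (ih ht.2.1).2, ht.2.2⟩⟩
  | iteB c a _ ih =>
    exact ⟨⟨ht.1, ht.2.1, (ih ht.2.2).1⟩, ⟨ht.1, ht.2.1, (ih ht.2.2).2⟩⟩

/-! ### Sequences with an inserted or removed entry -/

/-- Insert `a` at position `k` of a sequence. -/
def insertAt {α : Type*} (k : ℕ) (a : α) (γ : ℕ → α) : ℕ → α := fun n =>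
  if n < k then γ n else if n = k then a else γ (n - 1)

/-- Remove the entry at position `k` of a sequence. -/
def removeAt {α : Type*} (k : ℕ) (γ : ℕ → α) : ℕ → α := fun n =>
  if n < k then γ n else γ (n + 1)

theorem insertAt_self {α : Type*} (k : ℕ) (a : α) (γ : ℕ → α) : insertAt k a γ k = a := by
  simp [insertAt]

theorem insertAt_of_lt {α : Type*} {k n : ℕ} (h : n < k) (a : α) (γ : ℕ → α) :
    insertAt k a γ n = γ n := by
  simp [insertAt, h]

theorem insertAt_of_gt {α : Type*} {k n : ℕ} (h : k < n) (a : α) (γ : ℕ → α) :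
    insertAt k a γ n = γ (n - 1) := by
  simp [insertAt, h.not_gt, h.ne']

theorem insertAt_zero_succ {α : Type*} (a : α) (γ : ℕ → α) (n : ℕ) :
    insertAt 0 a γ (n + 1) = γ n := by
  simp [insertAt]

theorem insertAt_zero_insertAt {α : Type*} (k : ℕ) (a b : α) (γ : ℕ → α) :
    insertAt 0 b (insertAt k a γ) = insertAt (k + 1) a (insertAt 0 b γ) := by
  funext n
  rcases n with _ | n
  · simp [insertAt]
  · rw [insertAt_zero_succ]
    rcases lt_trichotomy n k with h | rfl | h
    · rw [insertAt_of_lt h, insertAt_of_lt (by omega), insertAt_zero_succ]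
    · rw [insertAt_self, insertAt_self]
    · obtain ⟨m, rfl⟩ : ∃ m, n = m + 1 := ⟨n - 1, by omega⟩
      rw [insertAt_of_gt h, insertAt_of_gt (by omega), Nat.add_sub_cancel, Nat.add_sub_cancel,
        insertAt_zero_succ]

theorem removeAt_zero_insertAt {α : Type*} (a : α) (γ : ℕ → α) :
    removeAt 0 (insertAt 0 a γ) = γ := by
  funext n; simp [removeAt, insertAt]

theorem removeAt_succ_insertAt {α : Type*} (k : ℕ) (a : α) (γ : ℕ → α) :
    removeAt (k + 1) (insertAt 0 a γ) = insertAt 0 a (removeAt k γ) := by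
  funext n
  rcases n with _ | n
  · simp [removeAt, insertAt]
  · simp only [removeAt, insertAt_zero_succ, Nat.succ_lt_succ_iff]

/-! ### Denotational semantics -/

/-- Functions between rational vector spaces that preserve affine combinations. -/
def affineFunctions (V W : Type) [AddCommGroup V] [Module ℚ V] [AddCommGroup W] [Module ℚ W] :
    Submodule ℚ (V → W) where
  carrier := {F | ∀ x y (c : ℚ), F (x + c • (y - x)) = F x + c • (F y - F x)}
  add_mem' := by
    intro F G hF hG x y c
    simp only [Pi.add_apply, hF x y c, hG x y c]
    module
  zero_mem' := by intro x y c; simp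
  smul_mem' := by
    intro d F hF x y c
    simp only [Pi.smul_apply, hF x y c]
    module

/-- Interpretation of types: booleans as the probability of being `one`, arrows as
affine functions. -/
noncomputable def Sem : Ty → ModuleCat.{0} ℚ
  | .bool => ModuleCat.of ℚ ℚ
  | .arrow A B => ModuleCat.of ℚ (affineFunctions (Sem A) (Sem B))

/-- The rational number denoted by an element of the interpretation of booleans. -/
def toRat (x : Sem .bool) : ℚ := x

/-- A rational number as an element of the interpretation of booleans. -/
def ofRat (q : ℚ) : Sem .bool := q

theorem toRat_ofRat (q : ℚ) : toRat (ofRat q) = q := rfl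

theorem toRat_add (x y : Sem .bool) : toRat (x + y) = toRat x + toRat y := rfl

theorem toRat_sub (x y : Sem .bool) : toRat (x - y) = toRat x - toRat y := rfl

theorem toRat_smul (c : ℚ) (x : Sem .bool) : toRat (c • x) = c * toRat x := rfl

/-- Application of an element of the interpretation of an arrow type. -/
def ap {A B : Ty} (F : Sem (.arrow A B)) (x : Sem A) : Sem B :=
  (show affineFunctions (Sem A) (Sem B) from F).1 x

/-- An affine function as an element of the interpretation of an arrow type. -/
def abstr {A B : Ty} (F : Sem A → Sem B)
    (hF : ∀ x y (c : ℚ), F (x + c • (y - x)) = F x + c • (F y - F x)) : Sem (.arrow A B) :=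
  (⟨F, hF⟩ : affineFunctions (Sem A) (Sem B))

theorem ap_abstr {A B : Ty} (F : Sem A → Sem B)
    (hF : ∀ x y (c : ℚ), F (x + c • (y - x)) = F x + c • (F y - F x)) (x : Sem A) :
    ap (abstr F hF) x = F x := rfl

theorem ap_ext {A B : Ty} {F G : Sem (.arrow A B)} (h : ∀ x, ap F x = ap G x) : F = G :=
  Subtype.ext (funext h)

theorem ap_add {A B : Ty} (F G : Sem (.arrow A B)) (x : Sem A) :
    ap (F + G) x = ap F x + ap G x := rfl

theorem ap_sub {A B : Ty} (F G : Sem (.arrow A B)) (x : Sem A) :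
    ap (F - G) x = ap F x - ap G x := rfl

theorem ap_smul {A B : Ty} (c : ℚ) (F : Sem (.arrow A B)) (x : Sem A) :
    ap (c • F) x = c • ap F x := rfl

theorem ap_line {A B : Ty} (F : Sem (.arrow A B)) (x y : Sem A) (c : ℚ) :
    ap F (x + c • (y - x)) = ap F x + c • (ap F y - ap F x) :=
  (show affineFunctions (Sem A) (Sem B) from F).2 x y c

theorem ap_midpoint {A B : Ty} (F : Sem (.arrow A B)) (x y : Sem A) :
    ap F ((1 / 2 : ℚ) • (x + y)) = (1 / 2 : ℚ) • (ap F x + ap F y) := by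
  have h := ap_line F x y (1 / 2)
  rw [show x + (1 / 2 : ℚ) • (y - x) = (1 / 2 : ℚ) • (x + y) by module] at h
  rw [h]; module

/-- A value of every type, of which a variable reads the one of its own type. -/
abbrev Slot : Type := ∀ A, Sem A

/-- Environments. -/
abbrev Env : Type := ℕ → Slot

/-- The slot whose only relevant value is `x`. -/
noncomputable def slot {A : Ty} (x : Sem A) : Slot := Pi.single A x

theorem slot_self {A : Ty} (x : Sem A) : slot x A = x := Pi.single_eq_same _ _

theorem slot_line {A : Ty} (x y : Sem A) (c : ℚ) :
    slot (x + c • (y - x)) = slot x + c • (slot y - slot x) := by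
  simp only [slot, Pi.single_add, Pi.single_smul, Pi.single_sub]

/-- `Den Γ t A f`: in the simply typed context `Γ` the term `t` has type `A` and a
derivation of it denotes `f`. -/
inductive Den : (ℕ → Ty) → Tm → (A : Ty) → (Env → Sem A) → Prop
  | var {Γ : ℕ → Ty} {n : ℕ} {A : Ty} : Γ n = A → Den Γ (.var n) A (fun ρ => ρ n A)
  | lam {Γ : ℕ → Ty} {t : Tm} {A B : Ty} {f : Env → Sem B} (g : Env → Sem (.arrow A B)) :
      Den (insertAt 0 A Γ) t B f → (∀ ρ x, ap (g ρ) x = f (insertAt 0 (slot x) ρ)) →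
      Den Γ (.lam t) (.arrow A B) g
  | app {Γ : ℕ → Ty} {t u : Tm} {A B : Ty} {f : Env → Sem (.arrow A B)} {g : Env → Sem A} :
      Den Γ t (.arrow A B) f → Den Γ u A g → Den Γ (.app t u) B (fun ρ => ap (f ρ) (g ρ))
  | one (Γ : ℕ → Ty) : Den Γ .one .bool (fun _ => ofRat 1)
  | zero (Γ : ℕ → Ty) : Den Γ .zero .bool (fun _ => ofRat 0)
  | coin (Γ : ℕ → Ty) : Den Γ .coin .bool (fun _ => ofRat (1 / 2))
  | ite {Γ : ℕ → Ty} {c a b : Tm} {A : Ty} {h : Env → Sem .bool} {f g : Env → Sem A} :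
      Den Γ c .bool h → Den Γ a A f → Den Γ b A g →
      Den Γ (.ite c a b) A (fun ρ => toRat (h ρ) • f ρ + (1 - toRat (h ρ)) • g ρ)

theorem Den.lift {Γ : ℕ → Ty} {s : Tm} {A : Ty} {g : Env → Sem A} (h : Den Γ s A g) (k : ℕ)
    (X : Ty) : Den (insertAt k X Γ) (lift k s) A (fun ρ => g (removeAt k ρ)) := by
  induction h generalizing k with
  | @var _ n _ hA =>
    by_cases hn : n < k
    · simp only [_root_.lift, removeAt, hn, if_true]
      exact .var (by rw [insertAt_of_lt hn, hA])
    · simp only [_root_.lift, removeAt, hn, if_false]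
      exact .var (by rw [insertAt_of_gt (by omega), Nat.add_sub_cancel, hA])
  | lam g _ hg ih =>
    have := ih (k + 1)
    rw [← insertAt_zero_insertAt] at this
    refine .lam _ this fun ρ x => ?_
    rw [hg, removeAt_succ_insertAt]
  | app _ _ iht ihu => exact .app (iht k) (ihu k)
  | one | zero | coin => constructor
  | ite _ _ _ ihc iha ihb => exact .ite (ihc k) (iha k) (ihb k)

theorem Den.subst {Γ Γ' : ℕ → Ty} {t s : Tm} {A B : Ty} {f : Env → Sem B} {g : Env → Sem A}
    {k : ℕ} (ht : Den Γ' t B f) (hΓ : Γ' = insertAt k A Γ) (hs : Den Γ s A g) :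
    Den Γ (subst t k s) B (fun ρ => f (insertAt k (slot (g ρ)) ρ)) := by
  induction ht generalizing Γ s g k with
  | @var _ n _ hB =>
    subst hΓ
    rcases lt_trichotomy n k with h | rfl | h
    · simp only [_root_.subst, h.ne, h.not_gt, if_false, insertAt_of_lt h]
      exact .var (by rw [← hB, insertAt_of_lt h])
    · rw [insertAt_self] at hB
      subst hB
      simp only [_root_.subst, if_true, insertAt_self, slot_self]
      exact hs
    · simp only [_root_.subst, h.ne', h, if_false, if_true, insertAt_of_gt h]
      exact .var (by rw [← hB, insertAt_of_gt h])
  | @lam _ _ C _ _ g' _ hg ih =>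
    refine .lam _ (ih (by rw [hΓ, insertAt_zero_insertAt]) (hs.lift 0 C)) fun ρ x => ?_
    simp only [hg, insertAt_zero_insertAt, removeAt_zero_insertAt]
  | app _ _ iht ihu => exact .app (iht hΓ hs) (ihu hΓ hs)
  | one | zero | coin => constructor
  | ite _ _ _ ihc iha ihb => exact .ite (ihc hΓ hs) (iha hΓ hs) (ihb hΓ hs)

theorem insertAt_zero_congr_off {n : ℕ} {e : Slot} {ρ ρ' : Env} (h : ∀ m ≠ n, ρ m = ρ' m) :
    ∀ m ≠ n + 1, insertAt 0 e ρ m = insertAt 0 e ρ' m := by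
  rintro (_ | m) hm
  · rw [insertAt_self, insertAt_self]
  · rw [insertAt_zero_succ, insertAt_zero_succ, h m (by omega)]

theorem insertAt_zero_line (e : Slot) (ρ ρ' : Env) (c : ℚ) :
    insertAt 0 e (ρ + c • (ρ' - ρ)) =
      insertAt 0 e ρ + c • (insertAt 0 e ρ' - insertAt 0 e ρ) := by
  funext n
  rcases n with _ | n
  · simp [insertAt]
  · simp [insertAt_zero_succ]

theorem insertAt_zero_slot_line (e e' : Slot) (ρ : Env) (c : ℚ) :
    insertAt 0 (e + c • (e' - e)) ρ =
      insertAt 0 e ρ + c • (insertAt 0 e' ρ - insertAt 0 e ρ) := by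
  funext n
  rcases n with _ | n
  · simp [insertAt]
  · simp [insertAt_zero_succ]

theorem line_congr_off {n : ℕ} {ρ ρ' : Env} (h : ∀ m ≠ n, ρ m = ρ' m) (c : ℚ) :
    ∀ m ≠ n, (ρ + c • (ρ' - ρ)) m = ρ m := by
  intro m hm
  simp [h m hm]

/-- A denotation does not depend on unused variables. -/
theorem Den.eq_of_usage_eq_zero {Γ : ℕ → Ty} {t : Tm} {A : Ty} {f : Env → Sem A}
    (h : Den Γ t A f) {n : ℕ} (hn : usage n t = 0) {ρ ρ' : Env} (hρ : ∀ m ≠ n, ρ m = ρ' m) :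
    f ρ = f ρ' := by
  induction h generalizing n ρ ρ' with
  | @var _ m =>
    have hm : m ≠ n := by rintro rfl; simp [usage] at hn
    simp only [hρ m hm]
  | lam g _ hg ih =>
    refine ap_ext fun x => ?_
    rw [hg, hg]
    exact ih hn (insertAt_zero_congr_off hρ)
  | app _ _ iht ihu =>
    simp only [usage, Nat.add_eq_zero_iff] at hn
    simp only [iht hn.1 hρ, ihu hn.2 hρ]
  | one | zero | coin => rfl
  | ite _ _ _ ihc iha ihb =>
    simp only [usage, Nat.add_eq_zero_iff] at hn
    simp only [ihc hn.1 hρ, iha (by omega : usage n _ = 0) hρ, ihb (by omega : usage n _ = 0) hρ]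

/-- A denotation is affine in each variable used at most once. -/
theorem Den.line_of_usage_le_one {Γ : ℕ → Ty} {t : Tm} {A : Ty} {f : Env → Sem A}
    (h : Den Γ t A f) {n : ℕ} (hn : usage n t ≤ 1) {ρ ρ' : Env} (hρ : ∀ m ≠ n, ρ m = ρ' m)
    (c : ℚ) : f (ρ + c • (ρ' - ρ)) = f ρ + c • (f ρ' - f ρ) := by
  induction h generalizing n ρ ρ' with
  | var => rfl
  | lam g _ hg ih =>
    refine ap_ext fun x => ?_
    rw [ap_add, ap_smul, ap_sub, hg, hg, hg, insertAt_zero_line]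
    exact ih hn (insertAt_zero_congr_off hρ)
  | @app _ t u _ _ f g ht hu iht ihu =>
    simp only [usage] at hn
    beta_reduce
    rcases Nat.eq_zero_or_pos (usage n t) with h0 | h0
    · rw [ihu (by omega : usage n u ≤ 1) hρ, ht.eq_of_usage_eq_zero h0 (line_congr_off hρ c),
        ← ht.eq_of_usage_eq_zero h0 hρ, ap_line]
    · have h1 : usage n u = 0 := by omega
      rw [iht (by omega : usage n t ≤ 1) hρ, hu.eq_of_usage_eq_zero h1 (line_congr_off hρ c),
        ← hu.eq_of_usage_eq_zero h1 hρ, ap_add, ap_smul, ap_sub]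
  | one | zero | coin => simp
  | @ite _ d a b _ p f g hd ha hb ihd iha ihb =>
    simp only [usage] at hn
    beta_reduce
    rcases Nat.eq_zero_or_pos (usage n d) with h0 | h0
    · rw [iha (by omega : usage n a ≤ 1) hρ, ihb (by omega : usage n b ≤ 1) hρ,
        hd.eq_of_usage_eq_zero h0 (line_congr_off hρ c), ← hd.eq_of_usage_eq_zero h0 hρ]
      module
    · have h1 : usage n a = 0 := by omega
      have h2 : usage n b = 0 := by omega
      rw [ihd (by omega : usage n d ≤ 1) hρ, ha.eq_of_usage_eq_zero h1 (line_congr_off hρ c),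
        ← ha.eq_of_usage_eq_zero h1 hρ, hb.eq_of_usage_eq_zero h2 (line_congr_off hρ c),
        ← hb.eq_of_usage_eq_zero h2 hρ, toRat_add, toRat_smul, toRat_sub]
      module

theorem Den.exists_lam {Γ : ℕ → Ty} {t : Tm} {A B : Ty} {f : Env → Sem B}
    (h : Den (insertAt 0 A Γ) t B f) (hu : usage 0 t ≤ 1) :
    ∃ g : Env → Sem (.arrow A B), Den Γ (.lam t) (.arrow A B) g ∧
      ∀ ρ x, ap (g ρ) x = f (insertAt 0 (slot x) ρ) := by
  refine ⟨fun ρ => abstr (fun x => f (insertAt 0 (slot x) ρ)) fun x y c => ?_, ?_, ?_⟩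
  · rw [slot_line, insertAt_zero_slot_line]
    refine h.line_of_usage_le_one hu (fun m hm => ?_) c
    rw [insertAt_of_gt (by omega), insertAt_of_gt (by omega)]
  · exact .lam _ h fun ρ x => ap_abstr _ _ x
  · exact fun ρ x => ap_abstr _ _ x

theorem exists_den_of_subTy {Γ : Ctx} {t : Tm} {A : Ty} (h : SubTy Γ t A) {Γ' : ℕ → Ty}
    (hΓ : ∀ n B, Γ n = some B → Γ' n = B) : ∃ f, Den Γ' t A f := by
  induction h generalizing Γ' with
  | var hn =>
    exact ⟨_, .var (hΓ _ _ hn)⟩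
  | @lam _ _ A _ h ih =>
    obtain ⟨f, hf⟩ := ih (Γ' := insertAt 0 A Γ') (by
      rintro (_ | n) B hB
      · rw [insertAt_self]; exact Option.some.inj hB
      · rw [insertAt_zero_succ]; exact hΓ n B hB)
    obtain ⟨g, hg, -⟩ := hf.exists_lam (usage_le_one_of_subTy h 0)
    exact ⟨g, hg⟩
  | app hd _ _ iht ihu =>
    obtain ⟨f, hf⟩ := iht fun n B hB => hΓ n B (union_eq_some_left hB)
    obtain ⟨g, hg⟩ := ihu fun n B hB => hΓ n B (union_eq_some_right hd hB)
    exact ⟨_, .app hf hg⟩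
  | one => exact ⟨_, .one Γ'⟩
  | zero => exact ⟨_, .zero Γ'⟩
  | coin => exact ⟨_, .coin Γ'⟩
  | ite hd _ _ _ ihc iha ihb =>
    obtain ⟨h, hh⟩ := ihc fun n B hB => hΓ n B (union_eq_some_left hB)
    obtain ⟨f, hf⟩ := iha fun n B hB => hΓ n B (union_eq_some_right hd hB)
    obtain ⟨g, hg⟩ := ihb fun n B hB => hΓ n B (union_eq_some_right hd hB)
    exact ⟨_, .ite hh hf hg⟩

/-- Contraction preserves denotations on average. -/
theorem Den.of_pairStep {Γ : ℕ → Ty} {t x y : Tm} {A : Ty} {f : Env → Sem A}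
    (h : Den Γ t A f) (hs : PairStep t x y) (ht : AffineTm t) :
    ∃ fx fy, Den Γ x A fx ∧ Den Γ y A fy ∧ ∀ ρ, f ρ = (1 / 2 : ℚ) • (fx ρ + fy ρ) := by
  induction hs generalizing Γ A with
  | beta t r =>
    cases h with
    | app hl hr =>
      cases hl with
      | lam g hb hg =>
        refine ⟨_, _, hb.subst rfl hr, hb.subst rfl hr, fun ρ => ?_⟩
        beta_reduce
        rw [hg]; module
  | iteOne a b =>
    cases h with
    | ite hc ha hb =>
      cases hc
      refine ⟨_, _, ha, ha, fun ρ => ?_⟩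
      beta_reduce
      rw [toRat_ofRat]; module
  | iteZero a b =>
    cases h with
    | ite hc ha hb =>
      cases hc
      refine ⟨_, _, hb, hb, fun ρ => ?_⟩
      beta_reduce
      rw [toRat_ofRat]; module
  | coin =>
    cases h
    refine ⟨_, _, .one Γ, .zero Γ, fun ρ => ?_⟩
    change (1 / 2 : ℚ) = (1 / 2 : ℚ) * (1 + 0)
    norm_num
  | lam hs ih =>
    cases h with
    | lam g hb hg =>
      obtain ⟨fx, fy, hx, hy, hf⟩ := ih hb ht.2
      have hu := hs.usage_le ht.2 0
      obtain ⟨gx, hgx, hgx'⟩ := hx.exists_lam (hu.1.trans ht.1)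
      obtain ⟨gy, hgy, hgy'⟩ := hy.exists_lam (hu.2.trans ht.1)
      refine ⟨gx, gy, hgx, hgy, fun ρ => ap_ext fun v => ?_⟩
      rw [hg, hf, ap_smul, ap_add, hgx', hgy']
  | appL u _ ih =>
    cases h with
    | app hl hr =>
      obtain ⟨fx, fy, hx, hy, hf⟩ := ih hl ht.1
      refine ⟨_, _, .app hx hr, .app hy hr, fun ρ => ?_⟩
      beta_reduce
      rw [hf, ap_smul, ap_add]
  | appR t _ ih =>
    cases h with
    | app hl hr =>
      obtain ⟨fx, fy, hx, hy, hf⟩ := ih hr ht.2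
      refine ⟨_, _, .app hl hx, .app hl hy, fun ρ => ?_⟩
      beta_reduce
      rw [hf, ap_midpoint]
  | iteC a b _ ih =>
    cases h with
    | ite hc ha hb =>
      obtain ⟨fx, fy, hx, hy, hf⟩ := ih hc ht.1
      refine ⟨_, _, .ite hx ha hb, .ite hy ha hb, fun ρ => ?_⟩
      beta_reduce
      rw [hf, toRat_smul, toRat_add]; module
  | iteA c b _ ih =>
    cases h with
    | ite hc ha hb =>
      obtain ⟨fx, fy, hx, hy, hf⟩ := ih ha ht.2.1
      refine ⟨_, _, .ite hc hx hb, .ite hc hy hb, fun ρ => ?_⟩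
      beta_reduce
      rw [hf]; module
  | iteB c a _ ih =>
    cases h with
    | ite hc ha hb =>
      obtain ⟨fx, fy, hx, hy, hf⟩ := ih hb ht.2.2
      refine ⟨_, _, .ite hc ha hx, .ite hc ha hy, fun ρ => ?_⟩
      beta_reduce
      rw [hf]; module

/-! ### Progress and probabilities of closed booleans -/

theorem size_beta_lt {t r : Tm} (ht : usage 0 t ≤ 1) :
    size (subst t 0 r) < size (.app (.lam t) r) := by
  have h := size_subst_le t 0 r
  have h' := Nat.mul_le_mul_right (size r) ht
  simp only [size]
  omega

/-- A closed typed term is a value or has a size-decreasing contraction. -/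
theorem Den.progress {Γ : ℕ → Ty} {t : Tm} {A : Ty} {f : Env → Sem A} (h : Den Γ t A f)
    (ht : AffineTm t) (hc : ∀ k, usage k t = 0) :
    t = .one ∨ t = .zero ∨ (∃ s, t = .lam s) ∨
      ∃ x y, PairStep t x y ∧ size x < size t ∧ size y < size t := by
  induction h with
  | @var _ n => simpa [usage] using hc n
  | lam => exact .inr (.inr (.inl ⟨_, rfl⟩))
  | @app _ t u _ _ _ _ hl _ iht _ =>
    simp only [usage, Nat.add_eq_zero_iff] at hc
    refine .inr (.inr (.inr ?_))
    rcases iht ht.1 fun k => (hc k).1 with rfl | rfl | ⟨s, rfl⟩ | ⟨x, y, hs, hx, hy⟩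
    · cases hl
    · cases hl
    · exact ⟨_, _, .beta s u, size_beta_lt ht.1.1, size_beta_lt ht.1.1⟩
    · exact ⟨_, _, .appL u hs, by simp only [size]; omega, by simp only [size]; omega⟩
  | one => exact .inl rfl
  | zero => exact .inr (.inl rfl)
  | coin => exact .inr (.inr (.inr ⟨_, _, .coin, by simp [size], by simp [size]⟩))
  | @ite _ c a b _ _ _ _ hd _ _ ihc _ _ =>
    simp only [usage, Nat.add_eq_zero_iff] at hc
    refine .inr (.inr (.inr ?_))
    rcases ihc ht.1 fun k => (hc k).1 with rfl | rfl | ⟨s, rfl⟩ | ⟨x, y, hs, hx, hy⟩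
    · exact ⟨_, _, .iteOne a b, by simp only [size]; omega, by simp only [size]; omega⟩
    · exact ⟨_, _, .iteZero a b, by simp only [size]; omega, by simp only [size]; omega⟩
    · cases hd
    · exact ⟨_, _, .iteC a b hs, by simp only [size]; omega, by simp only [size]; omega⟩

/-- The closed affine boolean term `t` denotes the probability `p`. -/
def HasProb (t : Tm) (p : ℚ) : Prop :=
  AffineTm t ∧ (∀ k, usage k t = 0) ∧ ∃ f, Den (fun _ => .bool) t .bool f ∧ toRat (f 0) = p

theorem HasProb.of_pairStep {t x y : Tm} {p : ℚ} (h : HasProb t p) (hs : PairStep t x y) :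
    ∃ px py, HasProb x px ∧ HasProb y py ∧ p = 1 / 2 * (px + py) := by
  obtain ⟨ha, hc, f, hf, rfl⟩ := h
  obtain ⟨fx, fy, hx, hy, hxy⟩ := hf.of_pairStep hs ha
  have hu := hs.usage_le ha
  refine ⟨_, _, ⟨(hs.affineTm ha).1, fun k => ?_, fx, hx, rfl⟩,
    ⟨(hs.affineTm ha).2, fun k => ?_, fy, hy, rfl⟩, ?_⟩
  · exact Nat.le_zero.1 ((hu k).1.trans (hc k).le)
  · exact Nat.le_zero.1 ((hu k).2.trans (hc k).le)
  · rw [hxy, toRat_smul, toRat_add]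

theorem HasProb.progress {t : Tm} {p : ℚ} (h : HasProb t p) :
    t = .one ∨ t = .zero ∨ ∃ x y, PairStep t x y ∧ size x < size t ∧ size y < size t := by
  obtain ⟨ha, hc, f, hf, -⟩ := h
  rcases hf.progress ha hc with h | h | ⟨s, rfl⟩ | h
  · exact .inl h
  · exact .inr (.inl h)
  · cases hf
  · exact .inr (.inr h)

theorem HasProb.eq_one {p : ℚ} (h : HasProb .one p) : p = 1 := by
  obtain ⟨-, -, f, hf, rfl⟩ := h
  cases hf
  rfl

theorem HasProb.eq_zero {p : ℚ} (h : HasProb .zero p) : p = 0 := by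
  obtain ⟨-, -, f, hf, rfl⟩ := h
  cases hf
  rfl

theorem HasProb.unique {t : Tm} {p q : ℚ} (hp : HasProb t p) (hq : HasProb t q) : p = q := by
  induction hn : size t using Nat.strong_induction_on generalizing t p q with
  | _ n ih =>
    subst hn
    rcases hp.progress with rfl | rfl | ⟨x, y, hs, hx, hy⟩
    · rw [hp.eq_one, hq.eq_one]
    · rw [hp.eq_zero, hq.eq_zero]
    · obtain ⟨px, py, hpx, hpy, rfl⟩ := hp.of_pairStep hs
      obtain ⟨qx, qy, hqx, hqy, rfl⟩ := hq.of_pairStep hs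
      rw [ih _ hx hpx hqx rfl, ih _ hy hpy hqy rfl]

open Classical in
/-- The probability that a closed boolean term evaluates to `one`. -/
noncomputable def prob (t : Tm) : ℚ := if h : ∃ p, HasProb t p then h.choose else 0

theorem HasProb.prob_eq {t : Tm} {p : ℚ} (h : HasProb t p) : prob t = p := by
  have h' : ∃ p, HasProb t p := ⟨p, h⟩
  rw [prob, dif_pos h']
  exact h'.choose_spec.unique h

/-! ### Distributions of closed booleans -/

/-- Every term in the support is a closed affine boolean term. -/
def BoolDist (D : PDist) : Prop := ∀ t ∈ D.support, ∃ p, HasProb t p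

theorem mean_contract {φ : Tm → ℚ} {t x y : Tm} (h : φ t = 1 / 2 * (φ x + φ y)) (D : PDist) :
    Finsupp.linearCombination ℚ φ (D.erase t + D t • half x y) =
      Finsupp.linearCombination ℚ φ D := by
  conv_rhs => rw [← Finsupp.erase_add_single t D]
  simp only [half, map_add, map_smul, Finsupp.linearCombination_single, smul_eq_mul, h]
  ring

theorem support_contract_subset (D : PDist) (t x y : Tm) :
    (D.erase t + D t • half x y).support ⊆ D.support.erase t ∪ {x, y} := by
  intro r hr
  by_contra hn
  simp only [Finset.mem_union, Finset.mem_erase, Finset.mem_insert, Finset.mem_singleton,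
    not_or, not_and_or, not_not, Finsupp.mem_support_iff] at hn hr
  obtain ⟨h₁, h₂, h₃⟩ := hn
  apply hr
  have he : D.erase t r = 0 := by
    rcases h₁ with rfl | h₁
    · exact Finsupp.erase_same
    · rw [Finsupp.erase_apply]; split_ifs <;> simp [h₁]
  simp [half, he, Finsupp.single_eq_of_ne h₂, Finsupp.single_eq_of_ne h₃]

theorem BoolDist.dSteps {D D' : PDist} (hD : BoolDist D) (h : DSteps D D') :
    BoolDist D' ∧ Finsupp.linearCombination ℚ prob D' = Finsupp.linearCombination ℚ prob D ∧
      Finsupp.linearCombination ℚ (fun _ => (1 : ℚ)) D' =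
        Finsupp.linearCombination ℚ (fun _ => (1 : ℚ)) D := by
  induction h with
  | refl => exact ⟨hD, rfl, rfl⟩
  | @tail D₁ _ _ hs ih =>
    obtain ⟨hB, hp, hm⟩ := ih
    obtain ⟨t, E, ht, hE, rfl⟩ := hs
    obtain ⟨x, y, rfl, hxy⟩ := exists_pairStep hE
    obtain ⟨p, hpt⟩ := hB t (Finsupp.mem_support_iff.2 ht)
    obtain ⟨px, py, hx, hy, hpe⟩ := hpt.of_pairStep hxy
    refine ⟨fun r hr => ?_, ?_, ?_⟩
    · have := support_contract_subset D₁ t x y hr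
      simp only [Finset.mem_union, Finset.mem_erase, Finset.mem_insert,
        Finset.mem_singleton] at this
      rcases this with h | rfl | rfl
      · exact hB r h.2
      · exact ⟨px, hx⟩
      · exact ⟨py, hy⟩
    · rw [mean_contract (by rw [hpt.prob_eq, hx.prob_eq, hy.prob_eq, hpe]), hp]
    · rw [mean_contract (by norm_num), hm]

theorem BoolDist.exists_normal {D : PDist} (hD : BoolDist D) :
    ∃ F, DSteps D F ∧ ∀ t ∈ F.support, t = .one ∨ t = .zero := by
  induction hn : ∑ t ∈ D.support, 3 ^ size t using Nat.strong_induction_on generalizing D with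
  | _ n ih =>
    by_cases hF : ∀ t ∈ D.support, t = .one ∨ t = .zero
    · exact ⟨D, .refl, hF⟩
    push Not at hF
    obtain ⟨t, ht, h₁, h₀⟩ := hF
    obtain ⟨p, hp⟩ := hD t ht
    obtain ⟨x, y, hs, hx, hy⟩ := (hp.progress.resolve_left h₁).resolve_left h₀
    have hstep : DSteps D (D.erase t + D t • half x y) :=
      .single ⟨t, _, Finsupp.mem_support_iff.1 ht, hs.tStep, rfl⟩
    have hlt : ∑ r ∈ (D.erase t + D t • half x y).support, 3 ^ size r < n := by
      have hpx : 3 ^ (size x + 1) ≤ 3 ^ size t := Nat.pow_le_pow_right (by norm_num) hx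
      have hpy : 3 ^ (size y + 1) ≤ 3 ^ size t := Nat.pow_le_pow_right (by norm_num) hy
      have hpos : 0 < 3 ^ size x := by positivity
      have hsum := Finset.add_sum_erase D.support (fun r => 3 ^ size r) ht
      have hsub := Finset.sum_le_sum_of_subset (f := fun r => 3 ^ size r)
        (support_contract_subset D t x y)
      have hun : ∑ r ∈ D.support.erase t ∪ {x, y}, 3 ^ size r ≤
          ∑ r ∈ D.support.erase t, 3 ^ size r + ∑ r ∈ ({x, y} : Finset Tm), 3 ^ size r := by
        rw [← Finset.sum_union_inter]; omega
      have hpair : ∑ r ∈ ({x, y} : Finset Tm), 3 ^ size r ≤ 3 ^ size x + 3 ^ size y := by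
        by_cases hxy : x = y
        · simp [hxy]
        · rw [Finset.sum_pair hxy]
      simp only [pow_succ] at hpx hpy hsum hsub
      omega
    obtain ⟨F, hF, hv⟩ := ih _ hlt (hD.dSteps hstep).1 rfl
    exact ⟨F, hstep.trans hF, hv⟩

theorem linearCombination_of_values (φ : Tm → ℚ) {F : PDist}
    (hF : ∀ t ∈ F.support, t = .one ∨ t = .zero) :
    Finsupp.linearCombination ℚ φ F = F .one * φ .one + F .zero * φ .zero := by
  rw [Finsupp.linearCombination_apply,
    Finsupp.sum_of_support_subset (s := {.one, .zero}) F (fun t ht => by simpa using hF t ht) _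
      (by simp), Finset.sum_pair (by simp)]
  rfl

theorem hasProb_one : HasProb .one 1 := ⟨trivial, fun _ => rfl, _, .one _, rfl⟩

theorem hasProb_zero : HasProb .zero 0 := ⟨trivial, fun _ => rfl, _, .zero _, rfl⟩

theorem eq_of_values {F G : PDist} (hF : ∀ t ∈ F.support, t = .one ∨ t = .zero)
    (hG : ∀ t ∈ G.support, t = .one ∨ t = .zero)
    (hp : Finsupp.linearCombination ℚ prob F = Finsupp.linearCombination ℚ prob G)
    (hm : Finsupp.linearCombination ℚ (fun _ => (1 : ℚ)) F =
      Finsupp.linearCombination ℚ (fun _ => (1 : ℚ)) G) : F = G := by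
  simp only [linearCombination_of_values _ hF, linearCombination_of_values _ hG,
    hasProb_one.prob_eq, hasProb_zero.prob_eq, mul_one, mul_zero, add_zero] at hp hm
  ext t
  by_cases h₁ : t = .one
  · rw [h₁, hp]
  by_cases h₀ : t = .zero
  · rw [h₀]; linarith
  rw [Finsupp.notMem_support_iff.1 fun h => (hF t h).elim h₁ h₀,
    Finsupp.notMem_support_iff.1 fun h => (hG t h).elim h₁ h₀]

theorem normalDist_of_values {F : PDist} (hF : ∀ t ∈ F.support, t = .one ∨ t = .zero) :
    NormalDist F := by
  rintro t ht ⟨p, r, hs⟩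
  rcases hF t ht with rfl | rfl <;> cases hs

/-! ### Elimination contexts -/

theorem plug_injective (C : List Tm) : Function.Injective fun t => plug t C := by
  induction C with
  | nil => exact fun _ _ h => h
  | cons v C ih =>
    intro s t h
    exact (Tm.app.inj (ih h)).1

theorem pairStep_plug {t x y : Tm} (h : PairStep t x y) (C : List Tm) :
    PairStep (plug t C) (plug x C) (plug y C) := by
  induction C generalizing t x y with
  | nil => exact h
  | cons v C ih => exact ih (.appL v h)

theorem dSteps_plug {D D' : PDist} (h : DSteps D D') (C : List Tm) :
    DSteps (D.mapDomain fun t => plug t C) (D'.mapDomain fun t => plug t C) := by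
  refine h.lift _ ?_
  rintro D _ ⟨t, E, ht, hE, rfl⟩
  obtain ⟨x, y, rfl, hs⟩ := exists_pairStep hE
  have hap := Finsupp.mapDomain_apply (plug_injective C) D t
  refine ⟨plug t C, _, by rwa [hap], (pairStep_plug hs C).tStep, ?_⟩
  rw [hap, Finsupp.erase_eq_sub_single, Finsupp.erase_eq_sub_single, hap,
    Finsupp.mapDomain_add, Finsupp.mapDomain_sub, Finsupp.mapDomain_smul,
    Finsupp.mapDomain_single, mapDomain_half]

theorem exists_hasProb_of_subTy {t : Tm} (h : SubTy Ctx.empty t .bool) : ∃ p, HasProb t p := by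
  obtain ⟨f, hf⟩ := exists_den_of_subTy h (Γ' := fun _ => .bool) (by rintro n B ⟨⟩)
  exact ⟨_, affineTm_of_subTy h, fun k => usage_eq_zero_of_subTy h rfl, f, hf, rfl⟩

end SubAffine

/-- computational confluence of the sub-affine λ¢:
    if ⊢ t : A and t reduces (via distribution reduction) to D₁ and to
    D₂, then D₁ ≡ D₂. -/
theorem computational_confluence {t : Tm} {A : Ty}
    (ht : SubTy Ctx.empty t A) {E₁ E₂ : PDist}
    (h₁ : DSteps (Finsupp.single t 1) E₁)
    (h₂ : DSteps (Finsupp.single t 1) E₂) :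
    CompEquiv A E₁ E₂ := by
  intro C hC
  obtain ⟨p, hp⟩ := SubAffine.exists_hasProb_of_subTy (hC.2 t ht)
  have hD : SubAffine.BoolDist (Finsupp.single (plug t C) 1) := by
    intro r hr
    obtain rfl := Finset.mem_singleton.1 (Finsupp.support_single_subset hr)
    exact ⟨p, hp⟩
  have hs₁ := SubAffine.dSteps_plug h₁ C
  have hs₂ := SubAffine.dSteps_plug h₂ C
  rw [Finsupp.mapDomain_single] at hs₁ hs₂
  obtain ⟨F₁, hF₁, hv₁⟩ := (hD.dSteps hs₁).1.exists_normal
  obtain ⟨F₂, hF₂, hv₂⟩ := (hD.dSteps hs₂).1.exists_normal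
  obtain ⟨-, hp₁, hm₁⟩ := hD.dSteps (hs₁.trans hF₁)
  obtain ⟨-, hp₂, hm₂⟩ := hD.dSteps (hs₂.trans hF₂)
  obtain rfl := SubAffine.eq_of_values hv₁ hv₂ (hp₁.trans hp₂.symm) (hm₁.trans hm₂.symm)
  exact ⟨F₁, SubAffine.normalDist_of_values hv₁, hF₁, hF₂⟩
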